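/- Let n, δ ∈ ℕ with δ ≥ 3 and n ≥ 16. If G is a connected, C₄-free graph of order n, minimum degree δ and radius r, then π(G) ≥ ((δ² − 2⌊δ/2⌋ + 1)/(5(n−1)))·(r² − 8r + 127/8). -/

import Mathlib

open Finset in
/-- In a `C₄`-free graph every ball of radius two has at least `δ² - 2⌊δ/2⌋ + 1` vertices. -/
theorem SimpleGraph.le_card_ball_two_of_c4Free {V : Type*} [Fintype V] [DecidableEq V]
    (G : SimpleGraph V) [DecidableRel G.Adj] (hconn : G.Connected)
    (hc4 : ∀ a b c d : V, G.Adj a b → G.Adj b c → G.Adj c d → G.Adj d a → a ≠ c → b ≠ d → False)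
    (δ : ℕ) (hδ : ∀ x, δ ≤ G.degree x) (h1 : 1 ≤ δ) (x : V) :
    δ ^ 2 - 2 * (δ / 2) + 1 ≤ #{w | G.dist x w ≤ 2} := by
  classical
  obtain ⟨N, hN, hNcard⟩ : ∃ N ⊆ G.neighborFinset x, #N = δ :=
    exists_subset_card_eq (hδ x)
  have hadj : ∀ y ∈ N, G.Adj x y := fun y hy => by simpa using hN hy
  set S : Finset V := N.biUnion fun y => (G.neighborFinset y).erase x with hS
  have hScard : δ * (δ - 1) ≤ #S := by
    rw [hS, card_biUnion]
    · calc δ * (δ - 1) = ∑ y ∈ N, (δ - 1) := by simp [hNcard]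
        _ ≤ _ := by
          refine sum_le_sum fun y hy => ?_
          rw [card_erase_of_mem (by simpa using (hadj y hy).symm)]
          exact Nat.sub_le_sub_right (hδ y) 1
    · intro y hy z hz hyz
      rw [Function.onFun, Finset.disjoint_left]
      intro a ha hb
      simp only [mem_erase, mem_neighborFinset] at ha hb
      exact hc4 x y a z (hadj y hy) ha.2 hb.2.symm (hadj z hz).symm (Ne.symm ha.1) hyz
  let H : SimpleGraph V :=
    { Adj := fun a b => a ∈ N ∧ b ∈ N ∧ G.Adj a b
      symm := ⟨fun a b h => ⟨h.2.1, h.1, h.2.2.symm⟩⟩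
      loopless := ⟨fun a h => G.loopless.irrefl a h.2.2⟩ }
  have hodd : N ∩ S = ({a | Odd (H.degree a)} : Finset V) := by
    ext a
    have hle : H.degree a ≤ 1 := by
      rw [← H.card_neighborFinset_eq_degree, card_le_one]
      intro b hb c hc
      simp only [mem_neighborFinset] at hb hc
      by_contra hbc
      exact hc4 x b a c (hadj b hb.2.1) hb.2.2.symm hc.2.2 (hadj c hc.2.1).symm
        (hadj a hb.1).ne hbc
    have hpos : 0 < H.degree a ↔ a ∈ N ∩ S := by
      rw [H.degree_pos_iff_exists_adj]
      constructor
      · rintro ⟨b, ha, hb, hab⟩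
        simp only [hS, mem_inter, mem_biUnion, mem_erase, mem_neighborFinset]
        exact ⟨ha, b, hb, (hadj a ha).ne', hab.symm⟩
      · simp only [hS, mem_inter, mem_biUnion, mem_erase, mem_neighborFinset]
        rintro ⟨ha, b, hb, -, hab⟩
        exact ⟨b, ha, hb, hab.symm⟩
    rw [← hpos, mem_filter]
    have : Odd (H.degree a) ↔ 0 < H.degree a := by
      interval_cases H.degree a <;> simp
    simp [this]
  have heven : Even #(N ∩ S) := by
    rw [hodd]
    exact H.even_card_odd_degree_vertices
  have hinter : #(N ∩ S) ≤ 2 * (δ / 2) := by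
    have := card_le_card (inter_subset_left : N ∩ S ⊆ N)
    obtain ⟨m, hm⟩ := heven
    omega
  have hx : x ∉ N ∪ S := by
    simp only [hS, mem_union, mem_biUnion, mem_erase]
    rintro (h | ⟨y, -, h, -⟩)
    · exact (hadj x h).ne rfl
    · exact h rfl
  have hsub : insert x (N ∪ S) ⊆ ({w | G.dist x w ≤ 2} : Finset V) := by
    intro w hw
    simp only [hS, mem_insert, mem_union, mem_biUnion, mem_erase, mem_neighborFinset] at hw
    rw [mem_filter]
    refine ⟨mem_univ _, ?_⟩
    rcases hw with rfl | h | ⟨y, hy, -, h⟩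
    · simp
    · rw [SimpleGraph.dist_eq_one_iff_adj.2 (hadj w h)]; norm_num
    · have := hconn.dist_triangle (u := x) (v := y) (w := w)
      rw [SimpleGraph.dist_eq_one_iff_adj.2 (hadj y hy),
        SimpleGraph.dist_eq_one_iff_adj.2 h] at this
      exact this
  have hfinal := card_le_card hsub
  rw [card_insert_of_notMem hx] at hfinal
  have hunion := card_union_add_card_inter N S
  have hsq : δ ^ 2 = δ * (δ - 1) + δ := by
    obtain ⟨k, rfl⟩ := Nat.exists_eq_add_of_le' h1
    simp only [Nat.add_sub_cancel]
    ring
  omega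

open Finset in
/-- Disjoint balls of radius two with at least `F` vertices bound the total distance of a vertex. -/
theorem SimpleGraph.sum_dist_ge_of_ball_packing {V ι : Type*} [Fintype V] [DecidableEq V]
    (G : SimpleGraph V) (hconn : G.Connected) (F : ℕ)
    (hball : ∀ x, F ≤ #{w | G.dist x w ≤ 2}) (s : Finset ι) (c : ι → V)
    (hpair : ∀ i ∈ s, ∀ j ∈ s, i ≠ j → 5 ≤ G.dist (c i) (c j)) (v : V) :
    (F : ℤ) * ∑ i ∈ s, ((G.dist v (c i) : ℤ) - 2) ≤ ∑ w, (G.dist v w : ℤ) := by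
  have hdisj : (s : Set ι).PairwiseDisjoint
      fun i => ({w | G.dist (c i) w ≤ 2} : Finset V) := by
    intro i hi j hj hij
    refine Finset.disjoint_left.2 fun w h1 h2 => ?_
    simp only [mem_filter, mem_univ, true_and] at h1 h2
    have := hpair i hi j hj hij
    have := hconn.dist_triangle (u := c i) (v := w) (w := c j)
    rw [G.dist_comm (u := w)] at this
    omega
  calc (F : ℤ) * ∑ i ∈ s, ((G.dist v (c i) : ℤ) - 2)
      ≤ ∑ i ∈ s, ∑ w with G.dist (c i) w ≤ 2, (G.dist v w : ℤ) := by
        rw [mul_sum]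
        refine sum_le_sum fun i _ => ?_
        have hterm : ∀ w ∈ ({w | G.dist (c i) w ≤ 2} : Finset V),
            G.dist v (c i) - 2 ≤ G.dist v w := by
          intro w hw
          simp only [mem_filter, mem_univ, true_and] at hw
          have := hconn.dist_triangle (u := v) (v := w) (w := c i)
          rw [G.dist_comm (u := w)] at this
          omega
        have h := (Nat.mul_le_mul_right (G.dist v (c i) - 2) (hball (c i))).trans
          (by simpa using card_nsmul_le_sum _ _ _ hterm)
        calc (F : ℤ) * ((G.dist v (c i) : ℤ) - 2)
            ≤ (F : ℤ) * ((G.dist v (c i) - 2 : ℕ) : ℤ) :=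
              mul_le_mul_of_nonneg_left (by omega) (by positivity)
          _ ≤ _ := by exact_mod_cast h
    _ = ∑ w ∈ s.biUnion fun i => ({w | G.dist (c i) w ≤ 2} : Finset V), (G.dist v w : ℤ) :=
        (sum_biUnion hdisj).symm
    _ ≤ ∑ w, (G.dist v w : ℤ) :=
        sum_le_sum_of_subset_of_nonneg (subset_univ _) fun _ _ _ => by positivity

/-- Two vertices of a connected graph are joined by a geodesic, as a sequence of vertices. -/
theorem SimpleGraph.Connected.exists_geodesic {V : Type*} {G : SimpleGraph V}
    (hconn : G.Connected) (u v : V) :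
    ∃ z : ℕ → V, z 0 = u ∧ z (G.dist u v) = v ∧
      ∀ i j, i ≤ j → j ≤ G.dist u v → G.dist (z i) (z j) = j - i := by
  obtain ⟨p, hp⟩ := hconn.exists_walk_length_eq_dist u v
  have hle : ∀ i j, i ≤ j → j ≤ G.dist u v → G.dist (p.getVert i) (p.getVert j) ≤ j - i := by
    intro i j hij
    induction j, hij using Nat.le_induction with
    | base => simp
    | succ j hij ih =>
      intro hj
      have h1 := ih (by omega)
      have h2 := SimpleGraph.dist_eq_one_iff_adj.2 (p.adj_getVert_succ (i := j) (by omega))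
      have h3 := hconn.dist_triangle (u := p.getVert i) (v := p.getVert j) (w := p.getVert (j + 1))
      omega
  have hend : p.getVert (G.dist u v) = v := by rw [← hp]; exact p.getVert_length
  refine ⟨p.getVert, p.getVert_zero, hend, fun i j hij hj => le_antisymm (hle i j hij hj) ?_⟩
  have h1 := hle 0 i (by omega) (by omega)
  have h2 := hle j _ hj le_rfl
  rw [p.getVert_zero] at h1
  rw [hend] at h2
  have h3 := hconn.dist_triangle (u := u) (v := p.getVert i) (w := v)
  have h4 := hconn.dist_triangle (u := p.getVert i) (v := p.getVert j) (w := v)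
  omega

theorem two_mul_sum_range_sub_five_mul (a : ℤ) (q : ℕ) :
    2 * ∑ l ∈ Finset.range q, (a - 5 * l - 2) = q * (2 * a + 1 - 5 * q) := by
  induction q with
  | zero => simp
  | succ q ih =>
    rw [Finset.sum_range_succ, mul_add, ih]
    push_cast
    ring

theorem ten_mul_sum_range_sub_five_mul_ge (a b : ℕ) (hb : 3 ≤ b) (hab : b ≤ a) :
    (a : ℤ) ^ 2 + a - b * (b - 1) ≤
      10 * ∑ l ∈ Finset.range ((a - b) / 5 + 1), ((a : ℤ) - 5 * l - 2) := by
  have h := two_mul_sum_range_sub_five_mul a ((a - b) / 5 + 1)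
  obtain ⟨ρ, hρ, ha⟩ : ∃ ρ ≤ 4, a = b + 5 * ((a - b) / 5) + ρ := ⟨(a - b) % 5, by omega, by omega⟩
  generalize (a - b) / 5 = q at *
  have hZ : (a : ℤ) = b + 5 * q + ρ := by exact_mod_cast ha
  push_cast at h
  rw [hZ] at h ⊢
  have hb' : (3 : ℤ) ≤ b := by exact_mod_cast hb
  have hρ' : (ρ : ℤ) ≤ 4 := by exact_mod_cast hρ
  have hρ0 : (0 : ℤ) ≤ ρ := by positivity
  nlinarith [mul_nonneg (sub_nonneg.2 hρ') (sub_nonneg.2 hb'), mul_nonneg (sub_nonneg.2 hρ') hρ0]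

open Finset in
/-- A lower bound on the total distance of `v` from the distance to a single vertex `u`. -/
theorem SimpleGraph.sum_dist_ge_of_le_dist {V : Type*} [Fintype V] [DecidableEq V]
    (G : SimpleGraph V) (hconn : G.Connected) (F : ℕ)
    (hball : ∀ x, F ≤ #{w | G.dist x w ≤ 2}) (v u : V) (hu : 3 ≤ G.dist v u) :
    (F : ℤ) * ((G.dist v u : ℤ) ^ 2 + G.dist v u - 6) ≤ 10 * ∑ w, (G.dist v w : ℤ) := by
  obtain ⟨z, hz0, -, hz⟩ := hconn.exists_geodesic v u
  set e := G.dist v u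
  have hpack := G.sum_dist_ge_of_ball_packing hconn F hball (range ((e - 3) / 5 + 1))
    (fun l => z (e - 5 * l)) (by
      intro i hi j hj hij
      rw [mem_range] at hi hj
      rcases hij.lt_or_gt with h | h
      · rw [G.dist_comm, hz _ _ (by omega) (by omega)]; omega
      · rw [hz _ _ (by omega) (by omega)]; omega) v
  have hsum : ∑ l ∈ range ((e - 3) / 5 + 1), ((G.dist v (z (e - 5 * l)) : ℤ) - 2) =
      ∑ l ∈ range ((e - 3) / 5 + 1), ((e : ℤ) - 5 * l - 2) := by
    refine sum_congr rfl fun l hl => ?_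
    rw [mem_range] at hl
    have := hz 0 (e - 5 * l) (by omega) (by omega)
    rw [hz0] at this
    omega
  rw [hsum] at hpack
  have hge := ten_mul_sum_range_sub_five_mul_ge e 3 le_rfl hu
  have := mul_le_mul_of_nonneg_left hge (Int.natCast_nonneg F)
  push_cast at this
  linarith

open Finset in
/-- A lower bound on the total distance of `v` from two geodesics that start in `v` and diverge. -/
theorem SimpleGraph.sum_dist_ge_of_two_geodesics {V : Type*} [Fintype V] [DecidableEq V]
    (G : SimpleGraph V) (hconn : G.Connected) (F : ℕ)
    (hball : ∀ x, F ≤ #{w | G.dist x w ≤ 2}) (r : ℕ) (hecc : ∀ x, ∃ y, r ≤ G.dist x y)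
    (v u : V) (hu : ∀ w, G.dist v w ≤ G.dist v u) (hur : G.dist v u + 14 ≤ 2 * r) :
    (F : ℤ) * (2 * r ^ 2 - 16 * r + 32) ≤ 10 * ∑ w, (G.dist v w : ℤ) := by
  obtain ⟨z, hz0, -, hz⟩ := hconn.exists_geodesic v u
  have hre : r ≤ G.dist v u := by
    obtain ⟨y, hy⟩ := hecc v
    exact hy.trans (hu y)
  set e := G.dist v u
  obtain ⟨t, ht⟩ := Nat.exists_eq_add_of_le hre
  obtain ⟨y, hy⟩ := hecc (z (t + 9))
  obtain ⟨x, hx0, hx1, hx⟩ := hconn.exists_geodesic v y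
  have hme := hu y
  set m := G.dist v y
  have hzk := hz 0 (t + 9) (by omega) (by omega)
  rw [hz0] at hzk
  have hm : r ≤ m + (t + 9) := by
    have := hconn.dist_triangle (u := z (t + 9)) (v := v) (w := y)
    rw [G.dist_comm (v := v)] at this
    omega
  obtain ⟨s, hs⟩ := Nat.exists_eq_add_of_le hm
  have hfar : ∀ i j, i ≤ e → s / 2 + 5 ≤ j → j ≤ m → 5 ≤ G.dist (z i) (x j) := by
    intro i j hi hj hjm
    by_contra! hlt
    have hzi := hz 0 i (by omega) hi
    have hxj := hx 0 j (by omega) hjm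
    have hxm := hx j m hjm le_rfl
    rw [hz0] at hzi
    rw [hx0] at hxj
    rw [hx1] at hxm
    have h1 := hconn.dist_triangle (u := v) (v := z i) (w := x j)
    have h2 := hconn.dist_triangle (u := v) (v := x j) (w := z i)
    rw [G.dist_comm (u := x j)] at h2
    have h3 := hconn.dist_triangle (u := z (t + 9)) (v := z i) (w := y)
    have h4 := hconn.dist_triangle (u := z i) (v := x j) (w := y)
    rcases le_total i (t + 9) with h | h
    · have := hz i (t + 9) h (by omega)
      rw [G.dist_comm] at this
      omega
    · have := hz (t + 9) i h hi
      omega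
  obtain ⟨J, hJ⟩ : ∃ J, J = s / 2 + 5 := ⟨_, rfl⟩
  rw [← hJ] at hfar
  have hpack := G.sum_dist_ge_of_ball_packing hconn F hball
    ((range ((e - 3) / 5 + 1)).disjSum (range ((m - J) / 5 + 1)))
    (Sum.elim (fun l => z (e - 5 * l)) fun l => x (m - 5 * l)) (by
      rintro (i | i) hi (j | j) hj hij <;>
        simp only [inl_mem_disjSum, inr_mem_disjSum, mem_range, Sum.elim_inl, Sum.elim_inr,
          ne_eq, Sum.inl.injEq, Sum.inr.injEq] at hi hj hij ⊢
      · rcases Nat.lt_or_gt_of_ne hij with h | h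
        · rw [G.dist_comm, hz _ _ (by omega) (by omega)]; omega
        · rw [hz _ _ (by omega) (by omega)]; omega
      · exact hfar _ _ (by omega) (by omega) (by omega)
      · rw [G.dist_comm]
        exact hfar _ _ (by omega) (by omega) (by omega)
      · rcases Nat.lt_or_gt_of_ne hij with h | h
        · rw [G.dist_comm, hx _ _ (by omega) (by omega)]; omega
        · rw [hx _ _ (by omega) (by omega)]; omega) v
  have hsumz : ∑ l ∈ range ((e - 3) / 5 + 1), ((G.dist v (z (e - 5 * l)) : ℤ) - 2) =
      ∑ l ∈ range ((e - 3) / 5 + 1), ((e : ℤ) - 5 * l - 2) := by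
    refine sum_congr rfl fun l hl => ?_
    rw [mem_range] at hl
    have := hz 0 (e - 5 * l) (by omega) (by omega)
    rw [hz0] at this
    omega
  have hsumx : ∑ l ∈ range ((m - J) / 5 + 1), ((G.dist v (x (m - 5 * l)) : ℤ) - 2) =
      ∑ l ∈ range ((m - J) / 5 + 1), ((m : ℤ) - 5 * l - 2) := by
    refine sum_congr rfl fun l hl => ?_
    rw [mem_range] at hl
    have := hx 0 (m - 5 * l) (by omega) (by omega)
    rw [hx0] at this
    omega
  rw [sum_disjSum] at hpack
  simp only [Sum.elim_inl, Sum.elim_inr] at hpack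
  rw [hsumz, hsumx] at hpack
  have hgez := ten_mul_sum_range_sub_five_mul_ge e 3 le_rfl (by omega)
  have hgex := ten_mul_sum_range_sub_five_mul_ge m J (by omega) (by omega)
  have harith : (2 * r ^ 2 - 16 * r + 32 : ℤ) ≤ ((e : ℤ) ^ 2 + e - 6) + (m ^ 2 + m - J * (J - 1)) := by
    obtain ⟨p, hp⟩ : ∃ p, r = t + 14 + p := ⟨r - t - 14, by omega⟩
    have hmZ : (m : ℤ) = p + 5 + s := by omega
    have heZ : (e : ℤ) = 2 * t + 14 + p := by omega
    have hrZ : (r : ℤ) = t + 14 + p := by omega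
    have hJs : 2 * (J : ℤ) ≤ s + 10 := by omega
    have hJ5 : (5 : ℤ) ≤ J := by omega
    have hs0 : (0 : ℤ) ≤ s := by positivity
    have hp0 : (0 : ℤ) ≤ p := by positivity
    have ht0 : (0 : ℤ) ≤ t := by positivity
    have hJJ : 4 * ((J : ℤ) * (J - 1)) ≤ (s + 10) * (s + 8) := by nlinarith
    rw [hmZ, heZ, hrZ]
    nlinarith [mul_nonneg hp0 hs0, mul_nonneg ht0 ht0]
  have := mul_le_mul_of_nonneg_left (harith.trans (add_le_add hgez hgex)) (Int.natCast_nonneg F)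
  linarith

open Finset in
/-- A vertex all of whose distances are at most one excludes minimum degree three. -/
theorem SimpleGraph.exists_two_le_dist_of_c4Free {V : Type*} [Fintype V] [DecidableEq V]
    (G : SimpleGraph V) [DecidableRel G.Adj] (hconn : G.Connected)
    (hc4 : ∀ a b c d : V, G.Adj a b → G.Adj b c → G.Adj c d → G.Adj d a → a ≠ c → b ≠ d → False)
    (hδ : ∀ x, 3 ≤ G.degree x) (v : V) : ∃ w, 2 ≤ G.dist v w := by
  by_contra! h
  have hadj : ∀ w, w ≠ v → G.Adj v w := fun w hw => by
    rw [← SimpleGraph.dist_eq_one_iff_adj]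
    have := hconn.pos_dist_of_ne hw.symm
    have := h w
    omega
  obtain ⟨x, hx⟩ := (G.degree_pos_iff_exists_adj v).1 (by have := hδ v; omega)
  have hcard : 1 < #((G.neighborFinset x).erase v) := by
    have := hδ x
    rw [card_erase_of_mem (by simpa using hx.symm), G.card_neighborFinset_eq_degree]
    omega
  obtain ⟨a, ha, b, hb, hab⟩ := one_lt_card.1 hcard
  simp only [mem_erase, mem_neighborFinset] at ha hb
  exact hc4 v a x b (hadj a ha.1) ha.2.symm hb.2 (hadj b hb.1).symm hx.ne hab

open Finset in
/-- The bound on the total distance of a vertex of a `C₄`-free graph, with cleared denominators. -/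
theorem SimpleGraph.sum_dist_ge_of_c4Free {V : Type*} [Fintype V] [DecidableEq V]
    (G : SimpleGraph V) [DecidableRel G.Adj] (hconn : G.Connected)
    (hc4 : ∀ a b c d : V, G.Adj a b → G.Adj b c → G.Adj c d → G.Adj d a → a ≠ c → b ≠ d → False)
    (δ : ℕ) (h3 : 3 ≤ δ) (hδ : ∀ x, δ ≤ G.degree x)
    (r : ℕ) (hr : 2 ≤ r) (hecc : ∀ x, ∃ y, r ≤ G.dist x y) (v : V) :
    ((δ ^ 2 - 2 * (δ / 2) + 1 : ℕ) : ℤ) * (8 * (r ^ 2 - 8 * r) + 127) ≤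
      40 * ∑ w, (G.dist v w : ℤ) := by
  have hball := G.le_card_ball_two_of_c4Free hconn hc4 δ hδ (by omega)
  have hF : 7 ≤ δ ^ 2 - 2 * (δ / 2) + 1 := by
    have : 3 * δ ≤ δ ^ 2 := by nlinarith
    omega
  generalize δ ^ 2 - 2 * (δ / 2) + 1 = F at *
  have hF0 : (0 : ℤ) ≤ F := by positivity
  obtain ⟨u, -, hu⟩ := exists_max_image univ (G.dist v) ⟨v, mem_univ v⟩
  have hu' : ∀ w, G.dist v w ≤ G.dist v u := fun w => hu w (mem_univ w)
  have hre : r ≤ G.dist v u := by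
    obtain ⟨y, hy⟩ := hecc v
    exact hy.trans (hu' y)
  rcases hr.eq_or_lt with rfl | hr3
  · have hsum : (Fintype.card V : ℤ) - 1 ≤ ∑ w, (G.dist v w : ℤ) := by
      rw [← add_sum_erase univ _ (mem_univ v)]
      have hone : ∀ w ∈ univ.erase v, (1 : ℤ) ≤ G.dist v w := fun w hw => by
        have := hconn.pos_dist_of_ne (ne_of_mem_erase hw).symm
        omega
      have hcard : #(univ.erase v) + 1 = Fintype.card V := by
        rw [card_erase_add_one (mem_univ v), card_univ]
      have := card_nsmul_le_sum _ _ _ hone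
      simp only [nsmul_eq_mul, mul_one, SimpleGraph.dist_self] at this ⊢
      omega
    have : F ≤ Fintype.card V := (hball v).trans (card_le_univ _)
    push_cast
    omega
  · by_cases hcase : 15 ≤ r ∧ G.dist v u + 14 ≤ 2 * r
    · have := G.sum_dist_ge_of_two_geodesics hconn F hball r hecc v u hu' hcase.2
      linarith
    · have hsum := G.sum_dist_ge_of_le_dist hconn F hball v u (by omega)
      have harith : (8 * (r ^ 2 - 8 * r) + 127 : ℤ) ≤
          4 * ((G.dist v u : ℤ) ^ 2 + G.dist v u - 6) := by
        generalize G.dist v u = e at *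
        have hreZ : (r : ℤ) ≤ e := by exact_mod_cast hre
        rcases lt_or_ge r 15 with h | h
        · have hr3' : (3 : ℤ) ≤ r := by exact_mod_cast hr3
          have hr14 : (r : ℤ) ≤ 14 := by omega
          nlinarith
        · have hr15 : (15 : ℤ) ≤ r := by exact_mod_cast h
          have he : 2 * (r : ℤ) - 13 ≤ e := by omega
          nlinarith
      have := mul_le_mul_of_nonneg_left harith hF0
      linarith

theorem stmt17 {V : Type*} [Fintype V] [DecidableEq V] (G : SimpleGraph V)
    [DecidableRel G.Adj] (n δ r : ℕ) (hn : Fintype.card V = n) (hδ : G.minDegree = δ) (hconn : G.Connected) (h3 : 3 ≤ δ) (h16 : 16 ≤ n) (hc4 : (∀ a b c d : V, G.Adj a b → G.Adj b c → G.Adj c d → G.Adj d a → a ≠ c → b ≠ d → False))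
    (hrad : (⨅ v : V, Finset.univ.sup fun w : V => G.dist v w) = r) :
    ((δ ^ 2 - 2 * (δ / 2) + 1 : ℕ) : ℝ) / (5 * ((n : ℝ) - 1)) * ((r : ℝ) ^ 2 - 8 * (r : ℝ) + 127 / 8) ≤ (⨅ v : V, (∑ w : V, (G.dist v w : ℝ)) / ((n : ℝ) - 1)) := by
  have hne : Nonempty V := hconn.nonempty
  have hdeg : ∀ x, δ ≤ G.degree x := fun x => hδ ▸ G.minDegree_le_degree x
  have hecc : ∀ x, ∃ y, r ≤ G.dist x y := by
    intro x
    obtain ⟨y, -, hy⟩ := Finset.exists_mem_eq_sup Finset.univ Finset.univ_nonempty (G.dist x)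
    refine ⟨y, ?_⟩
    rw [← hrad, ← hy]
    exact ciInf_le (OrderBot.bddBelow _) x
  have hr : 2 ≤ r := by
    rw [← hrad]
    refine le_ciInf fun v => ?_
    obtain ⟨w, hw⟩ := G.exists_two_le_dist_of_c4Free hconn hc4 (fun x => h3.trans (hdeg x)) v
    exact hw.trans (Finset.le_sup (f := fun w => G.dist v w) (Finset.mem_univ w))
  have hn1 : (0 : ℝ) < (n : ℝ) - 1 := by
    have : (16 : ℝ) ≤ n := by exact_mod_cast h16
    linarith
  refine le_ciInf fun v => ?_
  have h := G.sum_dist_ge_of_c4Free hconn hc4 δ h3 hdeg r hr hecc v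
  have hR : ((δ ^ 2 - 2 * (δ / 2) + 1 : ℕ) : ℝ) * (8 * ((r : ℝ) ^ 2 - 8 * r) + 127) ≤
      40 * ∑ w, (G.dist v w : ℝ) := by exact_mod_cast h
  generalize ((δ ^ 2 - 2 * (δ / 2) + 1 : ℕ) : ℝ) = F at *
  rw [div_mul_eq_mul_div, div_le_div_iff₀ (by positivity) hn1]
  nlinarith
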